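/- There is an absolute constant C > 0 such that for every integer h ≥ 1, every real Δ > 0, and every polygonal domain P = P₀ \ ⋃_{i=1}^h interior(Pᵢ) in 𝒞(h) in which every hole satisfies diam₂(Pᵢ) ≤ Δ·diam₂(P), the geodesic diameter satisfies diam_g(P) ≤ C·(1 + min{h^{3/4}·Δ, h^{1/2}·Δ^{1/2}})·diam₂(P). -/

import Mathlib

open Set Metric ENNReal RealInnerProductSpace

noncomputable section

/-- The Euclidean plane. -/
abbrev Plane := EuclideanSpace ℝ (Fin 2)

/-- A convex polygon: the convex hull of a nonempty finite point set. -/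
def IsConvexPolygon (Q : Set Plane) : Prop :=
  ∃ S : Finset Plane, S.Nonempty ∧ Q = convexHull ℝ (S : Set Plane)

/-- `γ` is a continuous path from `s` to `t` (parametrized on `[0,1]`) with image in `P`. -/
def IsPathIn (P : Set Plane) (γ : ℝ → Plane) (s t : Plane) : Prop :=
  ContinuousOn γ (Set.Icc 0 1) ∧ γ 0 = s ∧ γ 1 = t ∧ Set.MapsTo γ (Set.Icc 0 1) P

/-- Length of a path: its total variation on `[0,1]`. -/
def pathLen (γ : ℝ → Plane) : ℝ≥0∞ := eVariationOn γ (Set.Icc 0 1)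

/-- Geodesic distance inside `P`: infimum of lengths of continuous paths
from `s` to `t` contained in `P`. -/
def geod (P : Set Plane) (s t : Plane) : ℝ≥0∞ :=
  ⨅ γ : {γ : ℝ → Plane // IsPathIn P γ s t}, pathLen γ.1

/-- Geodesic diameter of `P`. -/
def geodDiam (P : Set Plane) : ℝ≥0∞ :=
  ⨆ s ∈ P, ⨆ t ∈ P, geod P s t

/-- The width of a planar set: the minimum, over unit directions `v`,
of the extent of `C` in direction `v`. -/
def setWidth (C : Set Plane) : ℝ :=
  ⨅ v : {v : Plane // ‖v‖ = 1},
    (sSup ((fun x => ⟪x, v.1⟫) '' C) - sInf ((fun x => ⟪x, v.1⟫) '' C))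

/-! ### Upper bounds for the geodesic distance -/

/-- The geodesic distance from `s` to `t` in `P` is at most the nonnegative real `ℓ`. -/
def GeodLE (P : Set Plane) (s t : Plane) (ℓ : ℝ) : Prop :=
  0 ≤ ℓ ∧ geod P s t ≤ ENNReal.ofReal ℓ

lemma geod_symm_le (P : Set Plane) (s t : Plane) : geod P t s ≤ geod P s t := by
  refine le_iInf fun ⟨γ, hc, h0, h1, hm⟩ => ?_
  have hmaps : MapsTo (fun x : ℝ => 1 - x) (Icc 0 1) (Icc 0 1) := fun x hx =>
    ⟨by linarith [hx.2], by linarith [hx.1]⟩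
  refine (iInf_le _ ⟨γ ∘ fun x => 1 - x, hc.comp (by fun_prop) hmaps, by simpa using h1,
    by simpa using h0, hm.comp hmaps⟩).trans ?_
  exact eVariationOn.comp_le_of_antitoneOn _ _
    (fun x _ y _ hxy => sub_le_sub_left hxy 1) hmaps

lemma geod_triangle (P : Set Plane) (s t u : Plane) :
    geod P s u ≤ geod P s t + geod P t u := by
  refine ENNReal.le_iInf_add_iInf fun ⟨γ, hc, h0, h1, hm⟩ ⟨γ', hc', h0', h1', hm'⟩ => ?_
  set η : ℝ → Plane := fun x => if x ≤ 1 / 2 then γ (2 * x) else γ' (2 * x - 1) with hη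
  have e1 : EqOn η (γ ∘ fun x => 2 * x) (Icc 0 (1 / 2)) := fun x hx => if_pos hx.2
  have e2 : EqOn η (γ' ∘ fun x => 2 * x - 1) (Icc (1 / 2) 1) := fun x hx => by
    rcases hx.1.eq_or_lt with rfl | hlt
    · simp [hη, h1, h0']
    · exact if_neg hlt.not_ge
  have m1 : MapsTo (fun x : ℝ => 2 * x) (Icc 0 (1 / 2)) (Icc 0 1) := fun x hx =>
    ⟨by linarith [hx.1], by linarith [hx.2]⟩
  have m2 : MapsTo (fun x : ℝ => 2 * x - 1) (Icc (1 / 2) 1) (Icc 0 1) := fun x hx =>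
    ⟨by linarith [hx.1], by linarith [hx.2]⟩
  have hU : Icc (0 : ℝ) (1 / 2) ∪ Icc (1 / 2) 1 = Icc 0 1 :=
    Icc_union_Icc_eq_Icc (by norm_num) (by norm_num)
  have hpath : IsPathIn P η s u := by
    refine ⟨?_, ?_, ?_, ?_⟩
    · rw [← hU]
      exact ((hc.comp (by fun_prop) m1).congr e1).union_of_isClosed
        ((hc'.comp (by fun_prop) m2).congr e2) isClosed_Icc isClosed_Icc
    · simp [hη, h0]
    · norm_num [hη, h1']
    · rw [← hU]
      rintro x (hx | hx)
      · rw [e1 hx]; exact hm (m1 hx)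
      · rw [e2 hx]; exact hm' (m2 hx)
  refine (iInf_le _ ⟨η, hpath⟩).trans ?_
  have hsplit := eVariationOn.Icc_add_Icc η (s := univ) (a := 0) (b := 1 / 2) (c := 1)
    (by norm_num) (by norm_num) (mem_univ _)
  simp only [univ_inter] at hsplit
  refine hsplit.ge.trans (add_le_add ?_ ?_)
  · rw [eVariationOn.congr e1]
    exact eVariationOn.comp_le_of_monotoneOn _ _
      (fun x _ y _ hxy => mul_le_mul_of_nonneg_left hxy zero_le_two) m1
  · rw [eVariationOn.congr e2]
    exact eVariationOn.comp_le_of_monotoneOn _ _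
      (fun x _ y _ hxy => sub_le_sub_right (mul_le_mul_of_nonneg_left hxy zero_le_two) 1) m2

lemma GeodLE.symm {P : Set Plane} {s t : Plane} {ℓ : ℝ} (h : GeodLE P s t ℓ) : GeodLE P t s ℓ :=
  ⟨h.1, (geod_symm_le P s t).trans h.2⟩

lemma GeodLE.trans {P : Set Plane} {s t u : Plane} {a b : ℝ} (h : GeodLE P s t a)
    (h' : GeodLE P t u b) : GeodLE P s u (a + b) :=
  ⟨add_nonneg h.1 h'.1, (geod_triangle P s t u).trans
    ((add_le_add h.2 h'.2).trans (ENNReal.ofReal_add h.1 h'.1).ge)⟩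

lemma GeodLE.mono {P : Set Plane} {s t : Plane} {a b : ℝ} (h : GeodLE P s t a) (hab : a ≤ b) :
    GeodLE P s t b :=
  ⟨h.1.trans hab, h.2.trans (ENNReal.ofReal_le_ofReal hab)⟩

lemma geodLE_of_lipschitz {P : Set Plane} {γ : ℝ → Plane} {ℓ : ℝ} (hℓ : 0 ≤ ℓ)
    (hγ : ∀ x ∈ Icc (0 : ℝ) 1, ∀ y ∈ Icc (0 : ℝ) 1, dist (γ x) (γ y) ≤ ℓ * dist x y)
    (hP : MapsTo γ (Icc 0 1) P) : GeodLE P (γ 0) (γ 1) ℓ := by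
  have hL : LipschitzOnWith ℓ.toNNReal γ (Icc 0 1) :=
    LipschitzOnWith.of_dist_le_mul (by simpa [Real.coe_toNNReal _ hℓ] using hγ)
  refine ⟨hℓ, (iInf_le _ ⟨γ, hL.continuousOn, rfl, rfl, hP⟩).trans ?_⟩
  have h1 := hL.comp_eVariationOn_le (f := γ) (g := id) (s := Icc (0 : ℝ) 1) (mapsTo_id _)
  have h2 := (monotone_id.monotoneOn (Icc (0 : ℝ) 1)).eVariationOn_eq
    (a := 0) (b := 1) (by simp) (by simp)
  rw [inter_self] at h2
  rw [h2] at h1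
  simpa [ENNReal.ofReal, pathLen] using h1

lemma geodLE_of_segment {P : Set Plane} {s t : Plane} (h : segment ℝ s t ⊆ P) :
    GeodLE P s t (dist s t) := by
  have := geodLE_of_lipschitz (P := P) (γ := fun x => AffineMap.lineMap s t x)
    (dist_nonneg (x := s) (y := t)) (fun x _ y _ => by rw [dist_lineMap_lineMap, mul_comm])
    (fun x hx => h (by rw [segment_eq_image_lineMap]; exact mem_image_of_mem _ hx))
  simpa using this

/-! ### Nearest-point projection onto a convex set -/

/-- `v` is the nearest point to `u` in `K`, expressed by the variational inequality. -/
def IsNearest (K : Set Plane) (u v : Plane) : Prop :=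
  v ∈ K ∧ ∀ w ∈ K, ⟪u - v, w - v⟫ ≤ 0

lemma isNearest_self {K : Set Plane} {u : Plane} (hu : u ∈ K) : IsNearest K u u :=
  ⟨hu, by simp⟩

lemma exists_nearest {K : Set Plane} (hK : IsClosed K) (hconv : Convex ℝ K) (hne : K.Nonempty)
    (u : Plane) : ∃ v, IsNearest K u v := by
  obtain ⟨v, hv, h⟩ := exists_norm_eq_iInf_of_complete_convex hne hK.isComplete hconv u
  exact ⟨v, hv, (norm_eq_iInf_iff_real_inner_le_zero hconv hv).1 h⟩

lemma dist_nearest_le {K : Set Plane} {a b a' b' : Plane} (ha : IsNearest K a a')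
    (hb : IsNearest K b b') : dist a' b' ≤ dist a b := by
  have h1 := ha.2 b' hb.1
  have h2 := hb.2 a' ha.1
  have key : ‖a' - b'‖ ^ 2 ≤ ⟪a - b, a' - b'⟫ := by
    have e : ⟪a - b, a' - b'⟫ = ⟪a' - b', a' - b'⟫ - ⟪a - a', b' - a'⟫ - ⟪b - b', a' - b'⟫ := by
      simp only [inner_sub_left, inner_sub_right]; ring
    rw [e, real_inner_self_eq_norm_sq]; linarith
  have h3 := real_inner_le_norm (a - b) (a' - b')
  rw [dist_eq_norm, dist_eq_norm]
  by_contra! hlt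
  nlinarith [norm_nonneg (a - b), norm_nonneg (a' - b')]

lemma nearest_mem_frontier {K : Set Plane} {u v : Plane} (h : IsNearest K u v)
    (hu : u ∉ interior K) : v ∈ frontier K := by
  refine ⟨subset_closure h.1, fun hint => hu ?_⟩
  have hc : Filter.Tendsto (fun ε : ℝ => v + ε • (u - v)) (nhdsWithin 0 (Ioi 0)) (nhds v) := by
    have : Continuous fun ε : ℝ => v + ε • (u - v) := by fun_prop
    simpa using (this.tendsto 0).mono_left nhdsWithin_le_nhds
  obtain ⟨ε, hε, hε0⟩ := ((hc.eventually (isOpen_interior.mem_nhds hint)).and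
    self_mem_nhdsWithin).exists
  have h1 := h.2 _ (interior_subset hε)
  rw [add_sub_cancel_left, inner_smul_right, real_inner_self_eq_norm_sq] at h1
  have h2 : ‖u - v‖ = 0 := by
    have : (0 : ℝ) < ε := hε0
    by_contra hne
    have : 0 < ‖u - v‖ ^ 2 := by positivity
    nlinarith
  rwa [sub_eq_zero.1 (norm_eq_zero.1 h2)]

/-- A segment avoiding the interior of the convex set `K` projects to a path in the frontier
of `K` which is not longer. -/
lemma geodLE_frontier_of_segment {P K : Set Plane} {a b a' b' : Plane} (hK : IsClosed K)
    (hconv : Convex ℝ K) (hP : frontier K ⊆ P) (hab : ∀ x ∈ segment ℝ a b, x ∉ interior K)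
    (ha : IsNearest K a a') (hb : IsNearest K b b') : GeodLE P a' b' (dist a b) := by
  choose f hf using exists_nearest hK hconv ⟨a', ha.1⟩
  have hfa : f a = a' := by simpa using dist_nearest_le (hf a) ha
  have hfb : f b = b' := by simpa using dist_nearest_le (hf b) hb
  have := geodLE_of_lipschitz (P := P) (γ := fun x : ℝ => f (AffineMap.lineMap a b x))
    (dist_nonneg (x := a) (y := b))
    (fun x _ y _ => (dist_nearest_le (hf _) (hf _)).trans
      (by rw [dist_lineMap_lineMap, mul_comm]))
    (fun x hx => hP (nearest_mem_frontier (hf _)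
      (hab _ (by rw [segment_eq_image_lineMap]; exact mem_image_of_mem _ hx))))
  simpa [hfa, hfb] using this

/-! ### Orthonormal frames, supporting lines and detours around a convex set -/

/-- `(e, f)` is an orthonormal basis of the plane. -/
structure IsFrame (e f : Plane) : Prop where
  inner_e : ⟪e, e⟫ = 1
  inner_f : ⟪f, f⟫ = 1
  inner_ef : ⟪e, f⟫ = 0
  expand : ∀ v : Plane, v = ⟪v, e⟫ • e + ⟪v, f⟫ • f

namespace IsFrame

variable {e f : Plane}

lemma inner_fe (h : IsFrame e f) : ⟪f, e⟫ = 0 := by rw [real_inner_comm, h.inner_ef]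

lemma neg_right (h : IsFrame e f) : IsFrame e (-f) :=
  ⟨h.inner_e, by simpa using h.inner_f, by simpa using h.inner_ef,
    fun v => by simpa using h.expand v⟩

lemma norm_e (h : IsFrame e f) : ‖e‖ = 1 := by
  have := h.inner_e
  rw [real_inner_self_eq_norm_sq] at this
  nlinarith [norm_nonneg e]

lemma norm_f (h : IsFrame e f) : ‖f‖ = 1 := by
  have := h.inner_f
  rw [real_inner_self_eq_norm_sq] at this
  nlinarith [norm_nonneg f]

lemma norm_comb_le (h : IsFrame e f) (x y : ℝ) : ‖x • e + y • f‖ ≤ |x| + |y| := by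
  refine (norm_add_le _ _).trans ?_
  rw [norm_smul, norm_smul, h.norm_e, h.norm_f, mul_one, mul_one, Real.norm_eq_abs,
    Real.norm_eq_abs]

lemma inner_comb_e (h : IsFrame e f) (x y : ℝ) : ⟪x • e + y • f, e⟫ = x := by
  rw [inner_add_left, real_inner_smul_left, real_inner_smul_left, h.inner_e, h.inner_fe]; ring

lemma inner_comb_f (h : IsFrame e f) (x y : ℝ) : ⟪x • e + y • f, f⟫ = y := by
  rw [inner_add_left, real_inner_smul_left, real_inner_smul_left, h.inner_f, h.inner_ef]; ring

end IsFrame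

/-- The frame making angle `θ` with the standard one. -/
lemma isFrame_rotation (θ : ℝ) :
    IsFrame !₂[Real.cos θ, Real.sin θ] !₂[-Real.sin θ, Real.cos θ] := by
  have h := Real.cos_sq_add_sin_sq θ
  refine ⟨?_, ?_, ?_, fun v => ?_⟩
  · rw [real_inner_self_eq_norm_sq, EuclideanSpace.norm_sq_eq]; simp
  · rw [real_inner_self_eq_norm_sq, EuclideanSpace.norm_sq_eq]; simp
  · simp [PiLp.inner_apply]; ring
  · ext i
    fin_cases i
    · simp [PiLp.inner_apply]; linear_combination (-(v 0)) * h
    · simp [PiLp.inner_apply]; linear_combination (-(v 1)) * h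

lemma segment_notMem_interior {K : Set Plane} {ν a b : Plane} {m : ℝ}
    (hK : ∀ z ∈ interior K, ⟪z, ν⟫ < m) (ha : m ≤ ⟪a, ν⟫) (hb : m ≤ ⟪b, ν⟫) :
    ∀ x ∈ segment ℝ a b, x ∉ interior K := by
  rintro x ⟨s, t, hs, ht, hst, rfl⟩ hx
  have := hK _ hx
  rw [inner_add_left, real_inner_smul_left, real_inner_smul_left] at this
  have hm : s * m + t * m = m := by rw [← add_mul, hst, one_mul]
  linarith [mul_le_mul_of_nonneg_left ha hs, mul_le_mul_of_nonneg_left hb ht]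

lemma exists_unit_normal {K : Set Plane} (hconv : Convex ℝ K) {p : Plane}
    (hp : p ∉ interior K) : ∃ ν : Plane, ‖ν‖ = 1 ∧ ∀ x ∈ interior K, ⟪x, ν⟫ < ⟪p, ν⟫ := by
  rcases (interior K).eq_empty_or_nonempty with h | ⟨z, hz⟩
  · exact ⟨_, (isFrame_rotation 0).norm_e, by simp [h]⟩
  obtain ⟨φ, hφ⟩ := geometric_hahn_banach_open_point hconv.interior isOpen_interior hp
  set ν := (InnerProductSpace.toDual ℝ Plane).symm φ with hν
  have hin : ∀ x, ⟪x, ν⟫ = φ x := fun x => by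
    rw [real_inner_comm, hν, InnerProductSpace.toDual_symm_apply]
  have hpos : 0 < ‖ν‖ := by
    rw [norm_pos_iff]
    intro h0
    have := hφ z hz
    rw [← hin, ← hin, h0] at this
    simp at this
  refine ⟨‖ν‖⁻¹ • ν, by rw [norm_smul, norm_inv, norm_norm, inv_mul_cancel₀ hpos.ne'],
    fun x hx => ?_⟩
  rw [real_inner_smul_right, real_inner_smul_right, hin, hin]
  exact mul_lt_mul_of_pos_left (hφ x hx) (inv_pos.2 hpos)

/-- Every frontier point of a convex set `K` of diameter at most `d` can be joined, along the
frontier, to the projection of a fixed corner of a large square around `K`. -/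
lemma geodLE_corner {P K : Set Plane} {e f o p c' : Plane} {d : ℝ} (hF : IsFrame e f)
    (hK : IsClosed K) (hconv : Convex ℝ K) (hP : frontier K ⊆ P) (hd : 0 < d)
    (hdiam : ∀ x ∈ K, ∀ y ∈ K, dist x y ≤ d) (ho : o ∈ K) (hp : p ∈ frontier K)
    (hc' : IsNearest K (o + ((2 * d) • e + (2 * d) • f)) c') :
    GeodLE P p c' (22 * d) := by
  have hpK : p ∈ K := hK.frontier_subset hp
  obtain ⟨ν, hν1, hν⟩ := exists_unit_normal hconv hp.2
  set a := p + (4 * d) • ν with ha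
  obtain ⟨a', ha'⟩ := exists_nearest hK hconv ⟨o, ho⟩ a
  have s0 : GeodLE P p a' (4 * d) := by
    refine (geodLE_frontier_of_segment hK hconv hP (a := p) (b := a)
      (segment_notMem_interior hν le_rfl ?_) (isNearest_self hpK) ha').mono ?_
    · rw [ha, inner_add_left, real_inner_smul_left, real_inner_self_eq_norm_sq, hν1]
      linarith
    · rw [ha, dist_self_add_right, norm_smul, hν1, Real.norm_of_nonneg (by positivity), mul_one]
  have hpo : ‖p - o‖ ≤ d := by rw [← dist_eq_norm]; exact hdiam _ hpK _ ho
  have h4 : ‖(4 * d) • ν‖ = 4 * d := by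
    rw [norm_smul, hν1, Real.norm_of_nonneg (by positivity), mul_one]
  have hao : a - o = (p - o) + (4 * d) • ν := by rw [ha]; abel
  have hup : ‖a - o‖ ≤ 5 * d := by
    rw [hao]; refine (norm_add_le _ _).trans ?_; rw [h4]; linarith
  have hlow : 3 * d ≤ ‖a - o‖ := by
    have := norm_sub_le (a - o) (p - o)
    rw [hao, add_sub_cancel_left, h4, ← hao] at this; linarith
  set X := ⟪a - o, e⟫ with hX
  set Y := ⟪a - o, f⟫ with hY
  have hX5 : |X| ≤ 5 * d := (abs_real_inner_le_norm _ _).trans (by rw [hF.norm_e]; linarith)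
  have hY5 : |Y| ≤ 5 * d := (abs_real_inner_le_norm _ _).trans (by rw [hF.norm_f]; linarith)
  have hsq : 9 * d ^ 2 ≤ X ^ 2 + Y ^ 2 := by
    have h1 : ⟪a - o, a - o⟫ = X ^ 2 + Y ^ 2 := by
      conv_lhs => rw [hF.expand (a - o)]
      rw [← hX, ← hY]
      simp only [inner_add_left, inner_add_right, real_inner_smul_left, real_inner_smul_right,
        hF.inner_e, hF.inner_f, hF.inner_ef, hF.inner_fe]
      ring
    rw [← h1, real_inner_self_eq_norm_sq]
    nlinarith
  have haexp : a = o + (X • e + Y • f) := by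
    rw [hX, hY, ← hF.expand]; abel
  have step : ∀ (g : Plane) (x y x' y' : ℝ) (b' c' : Plane), ‖g‖ = 1 →
      2 * d ≤ ⟪x • e + y • f, g⟫ → 2 * d ≤ ⟪x' • e + y' • f, g⟫ →
      IsNearest K (o + (x • e + y • f)) b' → IsNearest K (o + (x' • e + y' • f)) c' →
      GeodLE P b' c' (|x - x'| + |y - y'|) := by
    intro g x y x' y' b' c' hg h1 h2 hb hc
    refine (geodLE_frontier_of_segment hK hconv hP
      (segment_notMem_interior (ν := g) (m := ⟪o, g⟫ + 2 * d) (fun z hz => ?_) ?_ ?_)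
      hb hc).mono ?_
    · have h3 := (abs_le.1 (abs_real_inner_le_norm (z - o) g)).2
      have h4 := hdiam z (interior_subset hz) o ho
      rw [dist_eq_norm] at h4
      rw [hg, inner_sub_left] at h3
      linarith
    · rw [inner_add_left]; linarith
    · rw [inner_add_left]; linarith
    · rw [dist_eq_norm]
      have : o + (x • e + y • f) - (o + (x' • e + y' • f)) = (x - x') • e + (y - y') • f := by
        module
      rw [this]
      exact hF.norm_comb_le _ _
  have hne : ‖-e‖ = 1 := by rw [norm_neg, hF.norm_e]
  have hnf : ‖-f‖ = 1 := by rw [norm_neg, hF.norm_f]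
  rw [haexp] at ha'
  obtain ⟨hX5a, hX5b⟩ := abs_le.1 hX5
  obtain ⟨hY5a, hY5b⟩ := abs_le.1 hY5
  obtain ⟨c₁, hc₁⟩ := exists_nearest hK hconv ⟨o, ho⟩ (o + ((-(2 * d)) • e + (2 * d) • f))
  obtain ⟨c₂, hc₂⟩ := exists_nearest hK hconv ⟨o, ho⟩ (o + ((2 * d) • e + (-(2 * d)) • f))
  have hfar : ∀ x y : ℝ, -(5 * d) ≤ x → x ≤ 5 * d → |y| = 2 * d → |x - y| ≤ 7 * d := by
    intro x y h1 h2 h3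
    refine (abs_sub _ _).trans ?_
    rw [h3]
    linarith [abs_le.2 ⟨h1, h2⟩]
  have habs : |2 * d| = 2 * d := abs_of_pos (by linarith)
  have habs' : |-(2 * d)| = 2 * d := by rw [abs_neg, habs]
  have k1 := hfar X _ hX5a hX5b habs
  have k2 := hfar Y _ hY5a hY5b habs
  have k3 := hfar X _ hX5a hX5b habs'
  have k4 := hfar Y _ hY5a hY5b habs'
  have k5 : |-(2 * d) - 2 * d| = 4 * d := by
    rw [abs_of_nonpos (by linarith)]; ring
  by_cases c1 : 2 * d ≤ X
  · refine (s0.trans (step e _ _ _ _ _ _ hF.norm_e ?_ ?_ ha' hc')).mono (by linarith)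
    · rwa [hF.inner_comb_e]
    · rw [hF.inner_comb_e]
  by_cases c2 : 2 * d ≤ Y
  · refine (s0.trans (step f _ _ _ _ _ _ hF.norm_f ?_ ?_ ha' hc')).mono (by linarith)
    · rwa [hF.inner_comb_f]
    · rw [hF.inner_comb_f]
  by_cases c3 : X ≤ -(2 * d)
  · refine ((s0.trans (step (-e) _ _ _ _ _ _ hne ?_ ?_ ha' hc₁)).trans
      (step f _ _ _ _ _ _ hF.norm_f ?_ ?_ hc₁ hc')).mono ?_
    · rw [inner_neg_right, hF.inner_comb_e]; linarith
    · rw [inner_neg_right, hF.inner_comb_e]; linarith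
    · rw [hF.inner_comb_f]
    · rw [hF.inner_comb_f]
    · rw [k5, sub_self, abs_zero]; linarith
  · have c4 : Y ≤ -(2 * d) := by by_contra c4; nlinarith
    refine ((s0.trans (step (-f) _ _ _ _ _ _ hnf ?_ ?_ ha' hc₂)).trans
      (step e _ _ _ _ _ _ hF.norm_e ?_ ?_ hc₂ hc')).mono ?_
    · rw [inner_neg_right, hF.inner_comb_f]; linarith
    · rw [inner_neg_right, hF.inner_comb_f]; linarith
    · rw [hF.inner_comb_e]
    · rw [hF.inner_comb_e]
    · rw [k5, sub_self, abs_zero]; linarith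

/-- Two frontier points of a convex set of diameter at most `d` are joined along the frontier
by a path of length `O(d)`. -/
lemma geodLE_frontier {P K : Set Plane} {p q : Plane} {d : ℝ}
    (hK : IsClosed K) (hconv : Convex ℝ K) (hP : frontier K ⊆ P) (hd : 0 < d)
    (hdiam : ∀ x ∈ K, ∀ y ∈ K, dist x y ≤ d) (hp : p ∈ frontier K) (hq : q ∈ frontier K) :
    GeodLE P p q (44 * d) := by
  have hpK : p ∈ K := hK.frontier_subset hp
  have hF := isFrame_rotation 0
  obtain ⟨c', hc'⟩ := exists_nearest hK hconv ⟨p, hpK⟩ _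
  exact ((geodLE_corner hF hK hconv hP hd hdiam hpK hp hc').trans
    (geodLE_corner hF hK hconv hP hd hdiam hpK hq hc').symm).mono (by linarith)

/-! ### Domains with convex holes -/

/-- The outer region `P₀` with the interiors of the holes `Q i` removed. -/
abbrev freeRegion {ι : Type*} (P₀ : Set Plane) (Q : ι → Set Plane) : Set Plane :=
  P₀ \ ⋃ i, interior (Q i)

/-- A compact convex set of diameter at most `R` with disjoint compact convex holes of diameter
at most `d` in its interior. -/
structure HoleyDomain {ι : Type*} (P₀ : Set Plane) (Q : ι → Set Plane) (d R : ℝ) : Prop where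
  compact_outer : IsCompact P₀
  convex_outer : Convex ℝ P₀
  compact_hole : ∀ i, IsCompact (Q i)
  convex_hole : ∀ i, Convex ℝ (Q i)
  disjoint : Pairwise (Function.onFun Disjoint Q)
  subset : ∀ i, Q i ⊆ interior P₀
  dist_hole : ∀ i, ∀ x ∈ Q i, ∀ y ∈ Q i, dist x y ≤ d
  dist_outer : ∀ x ∈ P₀, ∀ y ∈ P₀, dist x y ≤ R
  pos : 0 < d
  le : d ≤ R

lemma Convex.line_mem {C : Set Plane} (hC : Convex ℝ C) {a v : Plane} {x y z : ℝ}
    (hx : a + x • v ∈ C) (hz : a + z • v ∈ C) (hxy : x ≤ y) (hyz : y ≤ z) : a + y • v ∈ C := by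
  have : Convex ℝ ((fun t : ℝ => a + t • v) ⁻¹' C) := by
    have e : (fun t : ℝ => a + t • v) = AffineMap.lineMap a (a + v) := by
      funext t; simp [AffineMap.lineMap_apply, add_comm]
    rw [e]
    exact hC.affine_preimage _
  exact this.ordConnected.out hx hz ⟨hxy, hyz⟩

lemma exists_mem_frontier_Icc {K : Set Plane} {a v : Plane} {α β x y : ℝ} (hx : x ∈ Icc α β)
    (hy : y ∈ Icc α β) (hxK : a + x • v ∈ K) (hyK : a + y • v ∉ K) :
    ∃ z ∈ Icc α β, a + z • v ∈ frontier K := by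
  have hpre : IsPreconnected ((fun t : ℝ => a + t • v) '' Icc α β) :=
    isPreconnected_Icc.image _ (by fun_prop)
  by_contra! hno
  have hcases : ∀ z ∈ Icc α β, a + z • v ∈ interior K ∨ a + z • v ∈ (closure K)ᶜ := by
    intro z hz
    by_contra! h
    exact hno z hz ⟨not_not.1 h.2, h.1⟩
  obtain ⟨w, -, hw, hw'⟩ := hpre _ _ isOpen_interior isClosed_closure.isOpen_compl
    (image_subset_iff.2 hcases)
    ⟨_, mem_image_of_mem _ hx, (hcases x hx).resolve_right fun h => h (subset_closure hxK)⟩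
    ⟨_, mem_image_of_mem _ hy, (hcases y hy).resolve_left fun h => hyK (interior_subset h)⟩
  exact hw' (subset_closure (interior_subset hw))

lemma exists_ray_mem_frontier {K : Set Plane} (hK : IsCompact K) {a v : Plane} (hv : v ≠ 0)
    (ha : a ∈ K) : ∃ z : ℝ, 0 ≤ z ∧ a + z • v ∈ frontier K := by
  obtain ⟨D, hD⟩ := hK.isBounded.subset_closedBall a
  have hv' : 0 < ‖v‖ := norm_pos_iff.2 hv
  have hout : a + ((|D| + 1) / ‖v‖) • v ∉ K := fun h => by
    have := hD h
    rw [mem_closedBall, dist_self_add_left, norm_smul, norm_div, norm_norm,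
      div_mul_cancel₀ _ hv'.ne', Real.norm_of_nonneg (by positivity)] at this
    linarith [le_abs_self D]
  obtain ⟨z, hz, h⟩ := exists_mem_frontier_Icc (K := K) (v := v)
    (left_mem_Icc.2 (show (0 : ℝ) ≤ (|D| + 1) / ‖v‖ by positivity))
    (right_mem_Icc.2 (by positivity)) (by simpa using ha) hout
  exact ⟨z, hz.1, h⟩

lemma line_segment_subset {S : Set Plane} {a v : Plane} {α β : ℝ} (hαβ : α ≤ β)
    (h : ∀ x ∈ Icc α β, a + x • v ∈ S) : segment ℝ (a + α • v) (a + β • v) ⊆ S := by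
  rintro _ ⟨s, t, hs, ht, hst, rfl⟩
  have : s • (a + α • v) + t • (a + β • v) = a + (s * α + t * β) • v := by
    rw [← sub_eq_zero]
    have : s • (a + α • v) + t • (a + β • v) - (a + (s * α + t * β) • v) = (s + t - 1) • a := by
      module
    rw [this, hst, sub_self, zero_smul]
  rw [this]
  refine h _ ⟨?_, ?_⟩
  · obtain rfl : s = 1 - t := by linarith
    nlinarith
  · obtain rfl : t = 1 - s := by linarith
    nlinarith

lemma dist_line {a v : Plane} {α β : ℝ} (hαβ : α ≤ β) (hv : ‖v‖ = 1) :
    dist (a + α • v) (a + β • v) = β - α := by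
  have : a + α • v - (a + β • v) = (-(β - α)) • v := by module
  rw [dist_eq_norm, this, norm_smul, hv, mul_one, norm_neg, Real.norm_of_nonneg (by linarith)]

namespace HoleyDomain

variable {ι : Type*} {P₀ : Set Plane} {Q : ι → Set Plane} {d R : ℝ}

lemma frontier_outer_subset (H : HoleyDomain P₀ Q d R) : frontier P₀ ⊆ freeRegion P₀ Q := by
  refine fun x hx => ⟨H.compact_outer.isClosed.frontier_subset hx, fun hx' => ?_⟩
  obtain ⟨i, hi⟩ := mem_iUnion.1 hx'
  exact hx.2 (H.subset i (interior_subset hi))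

lemma frontier_hole_subset (H : HoleyDomain P₀ Q d R) (i : ι) :
    frontier (Q i) ⊆ freeRegion P₀ Q := by
  refine fun x hx => ?_
  have hxi : x ∈ Q i := (H.compact_hole i).isClosed.frontier_subset hx
  refine ⟨interior_subset (H.subset i hxi), fun hx' => ?_⟩
  obtain ⟨j, hj⟩ := mem_iUnion.1 hx'
  by_cases hij : i = j
  · exact hx.2 (hij ▸ hj)
  · exact (H.disjoint hij).le_bot ⟨hxi, interior_subset hj⟩

lemma geodLE_hole (H : HoleyDomain P₀ Q d R) (i : ι) {p q : Plane} (hp : p ∈ frontier (Q i))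
    (hq : q ∈ frontier (Q i)) : GeodLE (freeRegion P₀ Q) p q (44 * d) :=
  geodLE_frontier (H.compact_hole i).isClosed (H.convex_hole i) (H.frontier_hole_subset i) H.pos
    (H.dist_hole i) hp hq

lemma geodLE_outer (H : HoleyDomain P₀ Q d R) {p q : Plane} (hp : p ∈ frontier P₀)
    (hq : q ∈ frontier P₀) : GeodLE (freeRegion P₀ Q) p q (44 * R) :=
  geodLE_frontier H.compact_outer.isClosed H.convex_outer H.frontier_outer_subset
    (H.pos.trans_le H.le) H.dist_outer hp hq

/-- Moving along a line inside `P₀`, one either never meets the interior of a hole or there is a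
first hole whose interior is entered. -/
lemma first_hit [Fintype ι] (H : HoleyDomain P₀ Q d R) {a v : Plane} {α : ℝ}
    (hα : a + α • v ∈ freeRegion P₀ Q) : ∀ β : ℝ, α ≤ β → (∀ x ∈ Icc α β, a + x • v ∈ P₀) →
    (∀ x ∈ Icc α β, a + x • v ∈ freeRegion P₀ Q) ∨
    ∃ i : ι, ∃ τ τ' : ℝ, α ≤ τ ∧ τ < τ' ∧ τ' ≤ β ∧
      (∀ x ∈ Icc α τ, a + x • v ∈ freeRegion P₀ Q) ∧ a + τ • v ∈ frontier (Q i) ∧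
      a + τ' • v ∈ interior (Q i) := by
  classical
  suffices key : ∀ I : Finset ι, ∀ β : ℝ, α ≤ β → (∀ x ∈ Icc α β, a + x • v ∈ P₀) →
      (∀ i, ∀ x ∈ Icc α β, a + x • v ∈ interior (Q i) → i ∈ I) →
      (∀ x ∈ Icc α β, a + x • v ∈ freeRegion P₀ Q) ∨
      ∃ i : ι, ∃ τ τ' : ℝ, α ≤ τ ∧ τ < τ' ∧ τ' ≤ β ∧
        (∀ x ∈ Icc α τ, a + x • v ∈ freeRegion P₀ Q) ∧ a + τ • v ∈ frontier (Q i) ∧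
        a + τ' • v ∈ interior (Q i) from
    fun β h1 h2 => key Finset.univ β h1 h2 fun i _ _ _ => Finset.mem_univ i
  intro I
  induction I using Finset.strongInduction with
  | H I ih =>
    intro β hαβ hβ hI
    by_cases hhit : ∃ i, ∃ x ∈ Icc α β, a + x • v ∈ interior (Q i)
    swap
    · push Not at hhit
      exact Or.inl fun x hx => ⟨hβ x hx, fun h => by
        obtain ⟨i, hi⟩ := mem_iUnion.1 h
        exact hhit i x hx hi⟩
    right
    obtain ⟨i, τ', hτ', hi⟩ := hhit
    obtain ⟨τ, hτ, hfr⟩ := exists_mem_frontier_Icc (K := interior (Q i))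
      (right_mem_Icc.2 hτ'.1) (left_mem_Icc.2 hτ'.1) hi
      fun h => hα.2 (mem_iUnion.2 ⟨i, h⟩)
    replace hfr := frontier_interior_subset hfr
    have hlt : τ < τ' := hτ.2.lt_of_ne fun h => hfr.2 (h ▸ hi)
    rcases ih (I.erase i) (Finset.erase_ssubset (hI i τ' hτ' hi)) τ hτ.1
      (fun x hx => hβ x ⟨hx.1, hx.2.trans (hτ.2.trans hτ'.2)⟩) (fun j x hx hj => by
        refine Finset.mem_erase.2 ⟨?_, hI j x ⟨hx.1, hx.2.trans (hτ.2.trans hτ'.2)⟩ hj⟩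
        rintro rfl
        exact hfr.2 ((H.convex_hole j).interior.line_mem hj hi hx.2 hlt.le)) with h | h
    · exact ⟨i, τ, τ', hτ.1, hlt, hτ'.2, h, hfr, hi⟩
    · obtain ⟨j, σ, σ', h1, h2, h3, h4⟩ := h
      exact ⟨j, σ, σ', h1, h2, h3.trans (hτ.2.trans hτ'.2), h4⟩

/-- Walking along a line and around each hole met costs `O(d)` per hole. -/
lemma geodLE_line [Fintype ι] (H : HoleyDomain P₀ Q d R) {a v : Plane} (hv : ‖v‖ = 1) {β : ℝ}
    (hβP : a + β • v ∈ freeRegion P₀ Q) (I : Finset ι) : ∀ α ≤ β, a + α • v ∈ freeRegion P₀ Q →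
    (∀ i, ∀ x ∈ Icc α β, a + x • v ∈ interior (Q i) → i ∈ I) →
    GeodLE (freeRegion P₀ Q) (a + α • v) (a + β • v) (β - α + 44 * d * I.card) := by
  classical
  induction I using Finset.strongInduction with
  | H I ih =>
    intro α hαβ hα hI
    have hd := H.pos
    rcases H.first_hit hα β hαβ
      (fun x hx => H.convex_outer.line_mem hα.1 hβP.1 hx.1 hx.2) with h | h
    · refine (geodLE_of_segment (line_segment_subset hαβ h)).mono ?_
      rw [dist_line hαβ hv]
      have : 0 ≤ 44 * d * I.card := by positivity
      linarith
    · obtain ⟨i, τ, τ', hατ, hττ', hτ'β, hfree, hfr, hint⟩ := h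
      obtain ⟨σ, hσ, hσfr⟩ := exists_mem_frontier_Icc (K := interior (Q i))
        (left_mem_Icc.2 hτ'β) (right_mem_Icc.2 hτ'β) hint
        fun h => hβP.2 (mem_iUnion.2 ⟨i, h⟩)
      replace hσfr := frontier_interior_subset hσfr
      have hiI : i ∈ I := hI i τ' ⟨hατ.trans hττ'.le, hτ'β⟩ hint
      have h1 := geodLE_of_segment (line_segment_subset hατ hfree)
      rw [dist_line hατ hv] at h1
      have h2 := H.geodLE_hole i hfr hσfr
      have h3 := ih (I.erase i) (Finset.erase_ssubset hiI) σ hσ.2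
        (H.frontier_hole_subset i hσfr) (fun j x hx hj => by
          refine Finset.mem_erase.2 ⟨?_, hI j x ⟨by linarith [hx.1, hσ.1], hx.2⟩ hj⟩
          rintro rfl
          exact hσfr.2 ((H.convex_hole j).interior.line_mem hint hj hσ.1 hx.1))
      refine ((h1.trans h2).trans h3).mono ?_
      have hcard : ((I.erase i).card : ℝ) = I.card - 1 := by
        rw [Finset.card_erase_of_mem hiI, Nat.cast_sub (Finset.card_pos.2 ⟨i, hiI⟩)]; simp
      rw [hcard]
      linarith [hσ.1]

end HoleyDomain

/-! ### Support functions and passing a hole monotonically -/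

/-- The support function of `K`. -/
def supp (K : Set Plane) (v : Plane) : ℝ := ⨆ x : K, ⟪(x : Plane), v⟫

/-- The total gap, in the directions `k • e ± f`, between the support function of `K` and a
support point of `K` in direction `e`. -/
def turn (K : Set Plane) (k : ℝ) (e f : Plane) : ℝ :=
  supp K (k • e + f) + supp K (k • e - f) - 2 * k * supp K e

lemma inner_le_supp {K : Set Plane} (hK : IsCompact K) {x : Plane} (hx : x ∈ K) (v : Plane) :
    ⟪x, v⟫ ≤ supp K v := by
  have hb : BddAbove ((fun x : Plane => ⟪x, v⟫) '' K) := (hK.image (by fun_prop)).bddAbove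
  exact le_ciSup (f := fun x : K => ⟪(x : Plane), v⟫)
    (by rwa [image_eq_range] at hb) ⟨x, hx⟩

lemma exists_inner_eq_supp {K : Set Plane} (hK : IsCompact K) (hne : K.Nonempty) (v : Plane) :
    ∃ r ∈ K, ⟪r, v⟫ = supp K v := by
  obtain ⟨r, hr, hmax⟩ := hK.exists_isMaxOn hne
    (f := fun x : Plane => ⟪x, v⟫) (by fun_prop)
  have : Nonempty K := hne.to_subtype
  exact ⟨r, hr, le_antisymm (inner_le_supp hK hr v) (ciSup_le fun x => hmax x.2)⟩

lemma inner_lt_supp_of_mem_interior {K : Set Plane} (hK : IsCompact K) {z v : Plane}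
    (hv : v ≠ 0) (hz : z ∈ interior K) : ⟪z, v⟫ < supp K v := by
  have hc : Filter.Tendsto (fun ε : ℝ => z + ε • v) (nhdsWithin 0 (Ioi 0)) (nhds z) := by
    have : Continuous fun ε : ℝ => z + ε • v := by fun_prop
    simpa using (this.tendsto 0).mono_left nhdsWithin_le_nhds
  obtain ⟨ε, hε, hε0⟩ := ((hc.eventually (isOpen_interior.mem_nhds hz)).and
    self_mem_nhdsWithin).exists
  have h1 := inner_le_supp hK (interior_subset hε) v
  rw [inner_add_left, real_inner_smul_left, real_inner_self_eq_norm_sq] at h1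
  have : (0 : ℝ) < ε := hε0
  have : 0 < ‖v‖ := norm_pos_iff.2 hv
  have : 0 < ε * ‖v‖ ^ 2 := by positivity
  linarith

lemma supp_smul (K : Set Plane) {c : ℝ} (hc : 0 ≤ c) (v : Plane) :
    supp K (c • v) = c * supp K v := by
  simp only [supp, real_inner_smul_right]
  exact (Real.mul_iSup_of_nonneg hc _).symm

lemma turn_neg (K : Set Plane) (k : ℝ) (e f : Plane) : turn K k e (-f) = turn K k e f := by
  simp only [turn, sub_neg_eq_add, ← sub_eq_add_neg]; ring

lemma supp_sub_inner_le_turn {K : Set Plane} (hK : IsCompact K) {k : ℝ} {e f r : Plane}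
    (hr : r ∈ K) (hre : ⟪r, e⟫ = supp K e) :
    supp K (k • e + f) - ⟪r, k • e + f⟫ ≤ turn K k e f := by
  have h := inner_le_supp hK hr (k • e - f)
  rw [inner_sub_right, real_inner_smul_right] at h
  rw [turn, ← hre, inner_add_right, real_inner_smul_right]
  linarith

lemma turn_nonneg {K : Set Plane} (hK : IsCompact K) (hne : K.Nonempty) (k : ℝ) (e f : Plane) :
    0 ≤ turn K k e f := by
  obtain ⟨r, hr, hre⟩ := exists_inner_eq_supp hK hne e
  exact (sub_nonneg.2 (inner_le_supp hK hr _)).trans (supp_sub_inner_le_turn hK hr hre)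

lemma geodLE_pass_aux {P K : Set Plane} {e f p r ν : Plane} {k τ : ℝ} (hF : IsFrame e f)
    (hK : IsCompact K) (hconv : Convex ℝ K) (hP : frontier K ⊆ P) (hp : p ∈ frontier K)
    (hτ : 0 < τ) (hpτ : p + τ • e ∈ interior K) (hr : r ∈ K) (hre : ⟪r, e⟫ = supp K e)
    (hk : 0 ≤ k) (hν : ∀ x ∈ interior K, ⟪x, ν⟫ < ⟪p, ν⟫) (hνf : 0 ≤ ⟪f, ν⟫) :
    GeodLE P p r ((1 + 3 * k) * (⟪r, e⟫ - ⟪p, e⟫) +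
      3 * (turn K k e f + turn K k (-e) f)) := by
  have hpK : p ∈ K := hK.isClosed.frontier_subset hp
  have hne : K.Nonempty := ⟨p, hpK⟩
  have he0 : e ≠ 0 := norm_ne_zero_iff.1 (by rw [hF.norm_e]; norm_num)
  have hνe : ⟪e, ν⟫ < 0 := by
    have := hν _ hpτ
    rw [inner_add_left, real_inner_smul_left] at this
    by_contra! h
    nlinarith
  have hνK : ∀ x ∈ K, ⟪x, ν⟫ ≤ ⟪p, ν⟫ := by
    intro x hx
    have hx' : x ∈ closure (interior K) := by
      rw [hconv.closure_interior_eq_closure_of_nonempty_interior ⟨_, hpτ⟩]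
      exact subset_closure hx
    exact closure_minimal (t := {x | ⟪x, ν⟫ ≤ ⟪p, ν⟫}) (fun y hy => (hν y hy).le)
      (isClosed_le (by fun_prop) (by fun_prop)) hx'
  -- coordinates
  have hcoord : ∀ x ∈ K, (⟪x, e⟫ - ⟪p, e⟫) * ⟪e, ν⟫ + (⟪x, f⟫ - ⟪p, f⟫) * ⟪f, ν⟫ ≤ 0 := by
    intro x hx
    have h1 := hνK x hx
    rw [← sub_nonpos, ← inner_sub_left, hF.expand (x - p), inner_add_left, real_inner_smul_left,
      real_inner_smul_left, inner_sub_left, inner_sub_left] at h1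
    exact h1
  set D := ⟪r, e⟫ - ⟪p, e⟫ with hD
  have hD0 : 0 ≤ D := sub_nonneg.2 (by rw [hre]; exact inner_le_supp hK hpK e)
  have hT := turn_nonneg hK hne k e f
  have hT' := turn_nonneg hK hne k (-e) f
  have hV : ⟪p, f⟫ - ⟪r, f⟫ ≤ k * D + turn K k e f := by
    have h1 := supp_sub_inner_le_turn hK (k := k) (f := f) hr hre
    have h2 := inner_le_supp hK hpK (k • e + f)
    rw [inner_add_right, real_inner_smul_right] at h1 h2
    rw [hD]; linarith
  -- from the vertical line through `r` down to `r`
  have last : ∀ (g : ℝ) (B' : Plane), g ≤ turn K k (-e) f →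
      ⟪r, f⟫ - ⟪p, f⟫ ≤ g + k * D →
      IsNearest K (p + (D • e + (g + k * D) • f)) B' →
      GeodLE P B' r (2 * k * D + turn K k e f + turn K k (-e) f) := by
    intro g B' hg hle hB'
    refine (geodLE_frontier_of_segment hK.isClosed hconv hP
      (segment_notMem_interior (ν := e) (m := supp K e)
        (fun z hz => inner_lt_supp_of_mem_interior hK he0 hz) ?_ hre.ge)
      hB' (isNearest_self hr)).mono ?_
    · rw [inner_add_left, hF.inner_comb_e, ← hre, hD]; linarith
    · have h1 : p + (D • e + (g + k * D) • f) - r =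
          (0 : ℝ) • e + (⟪p, f⟫ - ⟪r, f⟫ + (g + k * D)) • f := by
        have h2 := hF.expand (p - r)
        rw [inner_sub_left, inner_sub_left] at h2
        have : p + (D • e + (g + k * D) • f) - r = (p - r) + (D • e + (g + k * D) • f) := by abel
        rw [this, h2, hD]
        module
      rw [dist_eq_norm, h1]
      refine (hF.norm_comb_le _ _).trans ?_
      rw [abs_zero, abs_of_nonneg (by linarith)]
      linarith
  by_cases hsteep : 0 ≤ ⟪e, ν⟫ + k * ⟪f, ν⟫
  · obtain ⟨B', hB'⟩ := exists_nearest hK.isClosed hconv hne (p + (D • e + (0 + k * D) • f))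
    have hfpos : 0 < ⟪f, ν⟫ := by
      rcases hνf.eq_or_lt with h | h
      · rw [← h] at hsteep; linarith
      · exact h
    have hrise : ⟪r, f⟫ - ⟪p, f⟫ ≤ 0 + k * D := by
      have h1 := hcoord r hr
      rw [← hD] at h1
      by_contra! h
      nlinarith
    have s1 : GeodLE P p B' ((1 + k) * D) := by
      refine (geodLE_frontier_of_segment hK.isClosed hconv hP
        (segment_notMem_interior hν le_rfl ?_) (isNearest_self hpK) hB').mono ?_
      · rw [inner_add_left, inner_add_left, real_inner_smul_left, real_inner_smul_left]
        nlinarith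
      · rw [dist_self_add_right]
        refine (hF.norm_comb_le _ _).trans ?_
        rw [abs_of_nonneg hD0, abs_of_nonneg (by positivity)]
        linarith
    exact (s1.trans (last 0 B' hT' hrise hB')).mono (by nlinarith)
  · push Not at hsteep
    set μ := k • (-e) + f with hμ
    have hμin : ∀ x, ⟪x, μ⟫ = -k * ⟪x, e⟫ + ⟪x, f⟫ := fun x => by
      rw [hμ, inner_add_right, real_inner_smul_right, inner_neg_right]; ring
    set g := supp K μ - ⟪p, μ⟫ with hg
    have hg0 : 0 ≤ g := sub_nonneg.2 (inner_le_supp hK hpK μ)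
    have hgT : g ≤ turn K k (-e) f := by
      obtain ⟨l, hl, hle⟩ := exists_inner_eq_supp hK hne (-e)
      have h1 := supp_sub_inner_le_turn hK (k := k) (f := f) hl hle
      have h2 := inner_le_supp hK hpK (-e)
      rw [← hle, inner_neg_right, inner_neg_right] at h2
      have h3 := hcoord l hl
      rcases hνf.eq_or_lt with hf0 | hf0
      · refine supp_sub_inner_le_turn hK hpK ?_
        rw [← hf0] at h3
        rw [← hle, inner_neg_right, inner_neg_right]
        nlinarith
      · rw [← hμ] at h1
        refine le_trans ?_ h1
        rw [hg, hμin, hμin]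
        have h4 : k * (⟪p, e⟫ - ⟪l, e⟫) ≤ ⟪p, f⟫ - ⟪l, f⟫ := by
          by_contra! h
          nlinarith
        linarith
    obtain ⟨A', hA'⟩ := exists_nearest hK.isClosed hconv hne (p + ((0 : ℝ) • e + g • f))
    obtain ⟨B', hB'⟩ := exists_nearest hK.isClosed hconv hne (p + (D • e + (g + k * D) • f))
    have hrise : ⟪r, f⟫ - ⟪p, f⟫ ≤ g + k * D := by
      have h1 := inner_le_supp hK hr μ
      rw [hμin] at h1
      rw [hg, hμin, hD]
      linarith
    have hμf : ⟪f, μ⟫ = 1 := by rw [hμin, hF.inner_f, hF.inner_fe]; ring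
    have hμe : ⟪e, μ⟫ = -k := by rw [hμin, hF.inner_e, hF.inner_ef]; ring
    have hμ0 : μ ≠ 0 := fun h => by rw [h, inner_zero_right] at hμf; norm_num at hμf
    have s1 : GeodLE P p A' g := by
      refine (geodLE_frontier_of_segment hK.isClosed hconv hP
        (segment_notMem_interior hν le_rfl ?_) (isNearest_self hpK) hA').mono ?_
      · rw [inner_add_left, inner_add_left, real_inner_smul_left, real_inner_smul_left]
        nlinarith
      · rw [dist_self_add_right]
        refine (hF.norm_comb_le _ _).trans ?_
        rw [abs_zero, abs_of_nonneg hg0, zero_add]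
    have s2 : GeodLE P A' B' ((1 + k) * D) := by
      refine (geodLE_frontier_of_segment hK.isClosed hconv hP
        (segment_notMem_interior (ν := μ) (m := supp K μ)
          (fun z hz => inner_lt_supp_of_mem_interior hK hμ0 hz) ?_ ?_) hA' hB').mono ?_
      · simp only [inner_add_left, real_inner_smul_left, hμf, hμe]
        rw [hg]; linarith
      · simp only [inner_add_left, real_inner_smul_left, hμf, hμe]
        rw [hg]; linarith
      · have : p + ((0 : ℝ) • e + g • f) - (p + (D • e + (g + k * D) • f)) =
            (-D) • e + (-(k * D)) • f := by module
        rw [dist_eq_norm, this]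
        refine (hF.norm_comb_le _ _).trans ?_
        rw [abs_neg, abs_neg, abs_of_nonneg hD0, abs_of_nonneg (by positivity)]
        linarith
    exact ((s1.trans s2).trans (last g B' hgT hrise hB')).mono (by nlinarith)

/-- A hole hit at `p` when moving in direction `e` can be followed along its frontier to a point
`r` extremal in direction `e`, at a cost proportional to the advance plus the turning gaps. -/
lemma geodLE_pass {P K : Set Plane} {e f p r : Plane} {k τ : ℝ} (hF : IsFrame e f)
    (hK : IsCompact K) (hconv : Convex ℝ K) (hP : frontier K ⊆ P) (hp : p ∈ frontier K)
    (hτ : 0 < τ) (hpτ : p + τ • e ∈ interior K) (hr : r ∈ K) (hre : ⟪r, e⟫ = supp K e)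
    (hk : 0 ≤ k) :
    GeodLE P p r ((1 + 3 * k) * (⟪r, e⟫ - ⟪p, e⟫) +
      3 * (turn K k e f + turn K k (-e) f)) := by
  obtain ⟨ν, -, hν⟩ := exists_unit_normal hconv hp.2
  rcases le_total 0 ⟪f, ν⟫ with h | h
  · exact geodLE_pass_aux hF hK hconv hP hp hτ hpτ hr hre hk hν h
  · have := geodLE_pass_aux hF.neg_right hK hconv hP hp hτ hpτ hr hre hk hν
      (by rw [inner_neg_left]; linarith)
    rwa [turn_neg, turn_neg] at this

/-! ### Greedy monotone paths -/

/-- The extra cost of passing `K` in direction `e`. -/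
def gap (K : Set Plane) (k : ℝ) (e f : Plane) : ℝ := turn K k e f + turn K k (-e) f

namespace HoleyDomain

variable {ι : Type*} {P₀ : Set Plane} {Q : ι → Set Plane} {d R : ℝ} {e f : Plane} {k : ℝ}

lemma geodLE_greedy [Fintype ι] (H : HoleyDomain P₀ Q d R) (hF : IsFrame e f) (hk : 0 ≤ k)
    (hne : ∀ i, (Q i).Nonempty) {c : ℝ} (I : Finset ι) : ∀ s ∈ freeRegion P₀ Q, ⟪s, e⟫ ≤ c →
    (∀ i, ⟪s, e⟫ < supp (Q i) e → i ∈ I) →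
    ∃ t ∈ freeRegion P₀ Q, (t ∈ frontier P₀ ∨ ⟪t, e⟫ = c) ∧
      GeodLE (freeRegion P₀ Q) s t
        ((1 + 3 * k) * (c - ⟪s, e⟫) + 3 * ∑ i ∈ I, gap (Q i) k e f + 44 * d) := by
  classical
  have hd := H.pos
  have he0 : e ≠ 0 := norm_ne_zero_iff.1 (by rw [hF.norm_e]; norm_num)
  have hgap : ∀ i, 0 ≤ gap (Q i) k e f := fun i =>
    add_nonneg (turn_nonneg (H.compact_hole i) (hne i) _ _ _)
      (turn_nonneg (H.compact_hole i) (hne i) _ _ _)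
  have hline : ∀ (s : Plane) (x : ℝ), ⟪s + x • e, e⟫ = ⟪s, e⟫ + x := fun s x => by
    rw [inner_add_left, real_inner_smul_left, hF.inner_e, mul_one]
  induction I using Finset.strongInduction with
  | H I ih =>
    intro s hs hsc hI
    have hsum : 0 ≤ ∑ i ∈ I, gap (Q i) k e f := Finset.sum_nonneg fun i _ => hgap i
    have hs0 : s + (0 : ℝ) • e ∈ freeRegion P₀ Q := by simpa using hs
    obtain ⟨β, hβ, hβP, hβc⟩ : ∃ β ∈ Icc 0 (c - ⟪s, e⟫), s + β • e ∈ P₀ ∧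
        (s + β • e ∈ frontier P₀ ∨ β = c - ⟪s, e⟫) := by
      by_cases h : s + (c - ⟪s, e⟫) • e ∈ P₀
      · exact ⟨_, right_mem_Icc.2 (by linarith), h, .inr rfl⟩
      · obtain ⟨z, hz, hfr⟩ := exists_mem_frontier_Icc (left_mem_Icc.2 (sub_nonneg.2 hsc))
          (right_mem_Icc.2 (sub_nonneg.2 hsc)) hs0.1 h
        exact ⟨z, hz, H.compact_outer.isClosed.frontier_subset hfr, .inl hfr⟩
    rcases H.first_hit hs0 β hβ.1
      (fun x hx => H.convex_outer.line_mem hs0.1 hβP hx.1 hx.2) with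
      h | ⟨i, τ, τ', hτ, hττ', hτ'β, hfree, hfr, hint⟩
    · have h1 := geodLE_of_segment (line_segment_subset hβ.1 h)
      rw [dist_line hβ.1 hF.norm_e, zero_smul, add_zero] at h1
      refine ⟨_, h β (right_mem_Icc.2 hβ.1), hβc.imp_right fun h => ?_, h1.mono ?_⟩
      · rw [hline, h]; ring
      · nlinarith [hβ.2, mul_nonneg hk (sub_nonneg.2 hsc)]
    · have h1 := geodLE_of_segment (line_segment_subset hτ hfree)
      rw [dist_line hτ hF.norm_e, zero_smul, add_zero, sub_zero] at h1
      have hpQ := (H.compact_hole i).isClosed.frontier_subset hfr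
      obtain ⟨r, hrQ, hr⟩ := exists_inner_eq_supp (H.compact_hole i) (hne i) e
      have hrfr : r ∈ frontier (Q i) := ⟨subset_closure hrQ, fun h =>
        (inner_lt_supp_of_mem_interior (H.compact_hole i) he0 h).ne hr⟩
      have hpr := inner_le_supp (H.compact_hole i) hpQ e
      rw [hline, ← hr] at hpr
      have hτc : τ ≤ c - ⟪s, e⟫ := by linarith [hβ.2]
      rcases le_or_gt ⟪r, e⟫ c with hrc | hrc
      · have h2 := geodLE_pass hF (H.compact_hole i) (H.convex_hole i) (H.frontier_hole_subset i)
          hfr (sub_pos.2 hττ') (by rwa [add_assoc, ← add_smul, add_sub_cancel]) hrQ hr hk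
        have hiI : i ∈ I := hI i <| by
          have := inner_lt_supp_of_mem_interior (H.compact_hole i) he0 hint
          rw [hline] at this
          linarith
        obtain ⟨t, ht, htc, h3⟩ := ih (I.erase i) (Finset.erase_ssubset hiI) r
          (H.frontier_hole_subset i hrfr) hrc fun j hj => by
            refine Finset.mem_erase.2 ⟨?_, hI j (by linarith)⟩
            rintro rfl
            exact hj.ne hr
        refine ⟨t, ht, htc, ((h1.trans h2).trans h3).mono ?_⟩
        rw [hline, ← Finset.add_sum_erase I _ hiI]
        simp only [gap]
        nlinarith [mul_nonneg hk hτ]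
      · have hpos : 0 < ⟪r, e⟫ - (⟪s, e⟫ + τ) := by linarith
        set x := (c - (⟪s, e⟫ + τ)) / (⟪r, e⟫ - (⟪s, e⟫ + τ)) with hx
        have hu : (s + τ • e) + x • (r - (s + τ • e)) ∈ Q i :=
          (H.convex_hole i).add_smul_sub_mem hpQ hrQ
            ⟨div_nonneg (by linarith) hpos.le, (div_le_one hpos).2 (by linarith)⟩
        have hf0 : f ≠ 0 := norm_ne_zero_iff.1 (by rw [hF.norm_f]; norm_num)
        obtain ⟨z, -, hz⟩ := exists_ray_mem_frontier (H.compact_hole i) hf0 hu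
        refine ⟨_, H.frontier_hole_subset i hz, .inr ?_,
          (h1.trans (H.geodLE_hole i hfr hz)).mono ?_⟩
        · rw [inner_add_left, inner_add_left, real_inner_smul_left, real_inner_smul_left,
            inner_sub_left, hline, hF.inner_fe, hx, div_mul_cancel₀ _ hpos.ne']
          ring
        · nlinarith [mul_nonneg hk (sub_nonneg.2 hsc)]

end HoleyDomain

/-! ### Averaging over directions -/

/-- The unit vector making angle `θ` with the first axis. -/
def dir (θ : ℝ) : Plane := !₂[Real.cos θ, Real.sin θ]

/-- The extent of `K` in the direction making angle `θ` with the first axis. -/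
def extent (K : Set Plane) (θ : ℝ) : ℝ := supp K (dir θ) + supp K (-dir θ)

lemma extent_le {K : Set Plane} (hK : IsCompact K) (hne : K.Nonempty) {d : ℝ}
    (hd : ∀ x ∈ K, ∀ y ∈ K, dist x y ≤ d) (θ : ℝ) : extent K θ ≤ d := by
  obtain ⟨r, hr, hr'⟩ := exists_inner_eq_supp hK hne (dir θ)
  obtain ⟨q, hq, hq'⟩ := exists_inner_eq_supp hK hne (-dir θ)
  have h1 : ‖dir θ‖ = 1 := (isFrame_rotation θ).norm_e
  have h2 := real_inner_le_norm (r - q) (dir θ)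
  rw [h1, mul_one, inner_sub_left, ← dist_eq_norm] at h2
  rw [extent, ← hr', ← hq', inner_neg_right]
  linarith [hd r hr q hq]

lemma extent_periodic (K : Set Plane) (θ : ℝ) : extent K (θ + 2 * Real.pi) = extent K θ := by
  simp [extent, dir]

lemma gap_dir (K : Set Plane) {δ : ℝ} (hδ : 0 < Real.sin δ) (θ : ℝ) :
    gap K (Real.cos δ / Real.sin δ) (dir θ) !₂[-Real.sin θ, Real.cos θ] =
      (extent K (θ + δ) + extent K (θ - δ) - 2 * Real.cos δ * extent K θ) / Real.sin δ := by
  have h1 : (Real.cos δ / Real.sin δ) • dir θ + !₂[-Real.sin θ, Real.cos θ] =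
      (Real.sin δ)⁻¹ • dir (θ + δ) := by
    ext i
    fin_cases i <;> (simp [dir, Real.cos_add, Real.sin_add]; field_simp)
    ring
  have h2 : (Real.cos δ / Real.sin δ) • dir θ - !₂[-Real.sin θ, Real.cos θ] =
      (Real.sin δ)⁻¹ • dir (θ - δ) := by
    ext i
    fin_cases i <;> (simp [dir, Real.cos_sub, Real.sin_sub]; field_simp)
  have h3 : (Real.cos δ / Real.sin δ) • -dir θ + !₂[-Real.sin θ, Real.cos θ] =
      (Real.sin δ)⁻¹ • -dir (θ - δ) := by
    rw [smul_neg _ (dir (θ - δ)), ← h2, smul_neg]; abel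
  have h4 : (Real.cos δ / Real.sin δ) • -dir θ - !₂[-Real.sin θ, Real.cos θ] =
      (Real.sin δ)⁻¹ • -dir (θ + δ) := by
    rw [smul_neg _ (dir (θ + δ)), ← h1, smul_neg]; abel
  simp only [gap, turn, extent]
  rw [h1, h2, h3, h4]
  simp only [supp_smul K (inv_pos.2 hδ).le]
  field_simp
  ring

lemma sum_range_shift {g : ℕ → ℝ} {n : ℕ} (h : g n = g 0) :
    ∑ j ∈ Finset.range n, g (j + 1) = ∑ j ∈ Finset.range n, g j := by
  have h1 := Finset.sum_range_succ g n
  rw [Finset.sum_range_succ'] at h1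
  linarith

lemma sum_gap_dir_le {K : Set Plane} (hK : IsCompact K) (hne : K.Nonempty) {d : ℝ}
    (hd : ∀ x ∈ K, ∀ y ∈ K, dist x y ≤ d) {n : ℕ} (hn : 4 ≤ n) {δ : ℝ}
    (hδ : δ = 2 * Real.pi / n) :
    ∑ j ∈ Finset.range n, gap K (Real.cos δ / Real.sin δ) (dir (j * δ))
      !₂[-Real.sin (j * δ), Real.cos (j * δ)] ≤ 10 * d := by
  have hn' : (4 : ℝ) ≤ n := by exact_mod_cast hn
  have hn0 : (0 : ℝ) < n := by linarith
  have hπ := Real.pi_pos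
  have hδ0 : 0 < δ := by rw [hδ]; positivity
  have hnδ : n * δ = 2 * Real.pi := by rw [hδ]; field_simp
  have hδ2 : δ ≤ Real.pi / 2 := by nlinarith
  have hsin : 0 < Real.sin δ := Real.sin_pos_of_pos_of_lt_pi hδ0 (by linarith)
  have hd0 : 0 ≤ d := by
    obtain ⟨x, hx⟩ := hne
    simpa using hd x hx x hx
  simp only [gap_dir K hsin]
  rw [← Finset.sum_div, Finset.sum_sub_distrib, Finset.sum_add_distrib, ← Finset.mul_sum]
  have h1 : ∑ j ∈ Finset.range n, extent K (j * δ + δ) =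
      ∑ j ∈ Finset.range n, extent K (j * δ) := by
    rw [← sum_range_shift (g := fun j : ℕ => extent K (j * δ))]
    · simp [add_mul]
    · rw [hnδ]; simpa using extent_periodic K 0
  have h2 : ∑ j ∈ Finset.range n, extent K (j * δ - δ) =
      ∑ j ∈ Finset.range n, extent K (j * δ) := by
    rw [← sum_range_shift (g := fun j : ℕ => extent K (j * δ - δ))]
    · simp [add_mul]
    · rw [hnδ]
      simpa [sub_eq_neg_add] using extent_periodic K (-δ)
  rw [h1, h2]
  have h3 : ∑ j ∈ Finset.range n, extent K (j * δ) ≤ n * d := by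
    simpa using Finset.sum_le_card_nsmul (Finset.range n) (fun j : ℕ => extent K (j * δ)) d
      fun j _ => extent_le hK hne hd _
  have h4 := Real.one_sub_sq_div_two_le_cos (x := δ)
  have h5 := Real.mul_le_sin hδ0.le hδ2
  have h6 : 2 - 2 * Real.cos δ ≤ δ ^ 2 := by linarith
  have h7 : 0 ≤ 2 - 2 * Real.cos δ := by linarith [Real.cos_le_one δ]
  rw [div_le_iff₀ hsin]
  have h8 : δ ^ 2 * (n * d) ≤ 10 * d * (2 / Real.pi * δ) := by
    have : δ ^ 2 * (n * d) = 2 / Real.pi * δ * (Real.pi ^ 2 * d) := by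
      rw [show δ ^ 2 * (n * d) = δ * (n * δ) * d by ring, hnδ]
      field_simp
    rw [this, mul_comm (10 * d)]
    have h9 : Real.pi ^ 2 ≤ 10 := by nlinarith [Real.pi_lt_d2]
    gcongr
  calc _ = (2 - 2 * Real.cos δ) * ∑ j ∈ Finset.range n, extent K (j * δ) := by ring
    _ ≤ (2 - 2 * Real.cos δ) * (n * d) := by gcongr
    _ ≤ δ ^ 2 * (n * d) := by gcongr
    _ ≤ _ := h8
    _ ≤ _ := by gcongr

/-- Some direction is cheap for all the holes together. -/
lemma HoleyDomain.exists_frame {ι : Type*} [Fintype ι] {P₀ : Set Plane} {Q : ι → Set Plane}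
    {d R : ℝ} (H : HoleyDomain P₀ Q d R) (hne : ∀ i, (Q i).Nonempty) {n : ℕ} (hn : 4 ≤ n) :
    ∃ (e f : Plane) (k : ℝ), IsFrame e f ∧ 0 ≤ k ∧ k ≤ n ∧
      n * ∑ i, gap (Q i) k e f ≤ 10 * Fintype.card ι * d := by
  have hn' : (4 : ℝ) ≤ n := by exact_mod_cast hn
  have hn0 : (0 : ℝ) < n := by linarith
  have hπ := Real.pi_pos
  obtain ⟨δ, hδ⟩ : ∃ δ, δ = 2 * Real.pi / n := ⟨_, rfl⟩
  have hδ0 : 0 < δ := by rw [hδ]; positivity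
  have hnδ : n * δ = 2 * Real.pi := by rw [hδ]; field_simp
  have hδ2 : δ ≤ Real.pi / 2 := by nlinarith
  have hsin : 0 < Real.sin δ := Real.sin_pos_of_pos_of_lt_pi hδ0 (by linarith)
  have hcos : 0 ≤ Real.cos δ := Real.cos_nonneg_of_neg_pi_div_two_le_of_le (by linarith) hδ2
  have h5 := Real.mul_le_sin hδ0.le hδ2
  have h6 : 2 / Real.pi * δ * n = 4 := by
    rw [mul_assoc, mul_comm δ, hnδ]; field_simp; norm_num
  have hle : ∑ j ∈ Finset.range n, ∑ i, gap (Q i) (Real.cos δ / Real.sin δ) (dir (j * δ))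
      !₂[-Real.sin (j * δ), Real.cos (j * δ)] ≤
      ∑ j ∈ Finset.range n, 10 * Fintype.card ι * d / n := by
    rw [Finset.sum_comm, Finset.sum_const, Finset.card_range, nsmul_eq_mul,
      mul_div_cancel₀ _ hn0.ne']
    refine (Finset.sum_le_card_nsmul _ _ (10 * d) fun i _ =>
      sum_gap_dir_le (H.compact_hole i) (hne i) (H.dist_hole i) hn hδ).trans_eq ?_
    rw [Finset.card_univ, nsmul_eq_mul]; ring
  obtain ⟨j, -, hj⟩ := Finset.exists_le_of_sum_le (Finset.nonempty_range_iff.2 (by omega)) hle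
  refine ⟨_, _, _, isFrame_rotation (j * δ), div_nonneg hcos hsin.le, ?_, ?_⟩
  · rw [div_le_iff₀ hsin]
    nlinarith [Real.cos_le_one δ]
  · rw [le_div_iff₀ hn0] at hj
    rw [mul_comm]; exact hj

/-! ### Reaching the outer boundary -/

namespace HoleyDomain

variable {ι : Type*} {P₀ : Set Plane} {Q : ι → Set Plane} {d R : ℝ} {e f : Plane}

open Classical in
/-- Among `m` parallel lines at mutual distance at least `2 * d`, one meets at most `|ι| / m` of
the holes. -/
lemma exists_line [Fintype ι] (H : HoleyDomain P₀ Q d R) (hF : IsFrame e f) (b : ℝ)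
    {m : ℕ} (hm : 0 < m) :
    ∃ j < m, m * (Finset.univ.filter fun i => ∃ x ∈ Q i, ⟪x, e⟫ = b + j * (2 * d)).card ≤
      Fintype.card ι := by
  have hd := H.pos
  by_contra! hno
  have h1 : ∑ j ∈ Finset.range m,
      (Finset.univ.filter fun i => ∃ x ∈ Q i, ⟪x, e⟫ = b + j * (2 * d)).card ≤
      Fintype.card ι := by
    have := Finset.sum_card_bipartiteAbove_eq_sum_card_bipartiteBelow (s := Finset.range m)
      (t := (Finset.univ : Finset ι)) (fun (j : ℕ) i => ∃ x ∈ Q i, ⟪x, e⟫ = b + j * (2 * d))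
    simp only [Finset.bipartiteAbove, Finset.bipartiteBelow] at this
    rw [this]
    refine (Finset.sum_le_card_nsmul _ _ 1 fun i _ => Finset.card_le_one.2 ?_).trans_eq (by simp)
    intro j hj l hl
    obtain ⟨x, hx, hxj⟩ := (Finset.mem_filter.1 hj).2
    obtain ⟨y, hy, hyl⟩ := (Finset.mem_filter.1 hl).2
    have h2 := (abs_real_inner_le_norm (x - y) e).trans_eq
      (by rw [hF.norm_e, mul_one, ← dist_eq_norm])
    rw [inner_sub_left, hxj, hyl, show b + (j : ℝ) * (2 * d) - (b + l * (2 * d)) =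
      (j - l) * (2 * d) by ring, abs_mul, abs_of_pos (by positivity : 0 < 2 * d)] at h2
    have h3 : |((j : ℤ) - l : ℤ)| < 1 := by
      have : |(j : ℝ) - l| < 1 := by nlinarith [H.dist_hole i x hx y hy]
      exact_mod_cast this
    have := Int.abs_lt_one_iff.1 h3
    omega
  have h4 := Finset.sum_lt_sum_of_nonempty (Finset.nonempty_range_iff.2 hm.ne')
    fun j hj => hno j (Finset.mem_range.1 hj)
  rw [Finset.sum_const, Finset.card_range, smul_eq_mul, ← Finset.mul_sum] at h4
  exact (lt_of_mul_lt_mul_left h4 m.zero_le).not_ge h1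

lemma geodLE_greedy_univ [Fintype ι] (H : HoleyDomain P₀ Q d R) (hne : ∀ i, (Q i).Nonempty)
    {n : ℕ} (hn : 4 ≤ n) : ∃ e f : Plane, IsFrame e f ∧ ∀ s ∈ freeRegion P₀ Q, ∀ c, ⟪s, e⟫ ≤ c →
      ∃ t ∈ freeRegion P₀ Q, (t ∈ frontier P₀ ∨ ⟪t, e⟫ = c) ∧ GeodLE (freeRegion P₀ Q) s t
        ((1 + 3 * n) * (c - ⟪s, e⟫) + 30 * (Fintype.card ι * d / n) + 44 * d) := by
  have hn0 : (0 : ℝ) < n := by exact_mod_cast (by omega : 0 < n)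
  obtain ⟨e, f, k, hF, hk, hkn, hgap⟩ := H.exists_frame hne hn
  refine ⟨e, f, hF, fun s hs c hc => ?_⟩
  obtain ⟨t, ht, htc, h⟩ := H.geodLE_greedy hF hk hne Finset.univ s hs hc
    fun i _ => Finset.mem_univ i
  refine ⟨t, ht, htc, h.mono ?_⟩
  have h1 : ∑ i, gap (Q i) k e f ≤ 10 * (Fintype.card ι * d / n) := by
    rw [← mul_div_assoc, le_div_iff₀ hn0]; linarith
  have h2 : (1 + 3 * k) * (c - ⟪s, e⟫) ≤ (1 + 3 * n) * (c - ⟪s, e⟫) :=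
    mul_le_mul_of_nonneg_right (by linarith) (sub_nonneg.2 hc)
  linarith

lemma exists_geodLE_frontier_outer_of_card_mul_eq [Fintype ι] (H : HoleyDomain P₀ Q d R)
    (hne : ∀ i, (Q i).Nonempty) {x : ℝ} (hx : 0 ≤ x) (hxR : Fintype.card ι * d = x ^ 2 * R)
    {s : Plane} (hs : s ∈ freeRegion P₀ Q) :
    ∃ t ∈ frontier P₀, GeodLE (freeRegion P₀ Q) s t (76 * R + 36 * x * R) := by
  have hd := H.pos
  have hR := hd.trans_le H.le
  obtain ⟨e, f, hF, h⟩ := H.geodLE_greedy_univ hne (Nat.le_add_left 4 ⌈x⌉₊)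
  obtain ⟨t, ht, htc, hst⟩ := h s hs (⟪s, e⟫ + 2 * R) (by linarith)
  refine ⟨t, htc.resolve_right fun htc => ?_, hst.mono ?_⟩
  · have h1 := real_inner_le_norm (t - s) e
    rw [hF.norm_e, mul_one, inner_sub_left, htc, ← dist_eq_norm] at h1
    linarith [H.dist_outer t ht.1 s hs.1]
  · have h1 := Nat.le_ceil x
    have h2 := (Nat.ceil_lt_add_one hx).le
    have h3 : Fintype.card ι * d / ((⌈x⌉₊ + 4 : ℕ) : ℝ) ≤ x * R := by
      rw [div_le_iff₀ (by positivity), hxR]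
      push_cast
      nlinarith [mul_nonneg hx hR.le]
    push_cast at h3 ⊢
    nlinarith [H.le]

lemma exists_geodLE_frontier_outer_of_card_eq [Fintype ι] (H : HoleyDomain P₀ Q d R)
    (hne : ∀ i, (Q i).Nonempty) {y : ℝ} (hy : 1 ≤ y) (hcard : Fintype.card ι = y ^ 4)
    {s : Plane} (hs : s ∈ freeRegion P₀ Q) :
    ∃ t ∈ frontier P₀, GeodLE (freeRegion P₀ Q) s t (45 * R + 150 * (y ^ 3 * d)) := by
  classical
  have hd := H.pos
  have hy0 : 0 < y := by linarith
  obtain ⟨e, f, hF, h⟩ := H.geodLE_greedy_univ hne (Nat.le_add_left 4 ⌈y⌉₊)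
  have hm : 0 < ⌈y ^ 2⌉₊ := Nat.ceil_pos.2 (by positivity)
  obtain ⟨j, hjm, hj⟩ := H.exists_line hF ⟪s, e⟫ hm
  set I := Finset.univ.filter fun i => ∃ x ∈ Q i, ⟪x, e⟫ = ⟪s, e⟫ + j * (2 * d)
  obtain ⟨t, ht, htc, hst⟩ := h s hs (⟪s, e⟫ + j * (2 * d)) (le_add_of_nonneg_right (by positivity))
  have hm1 := Nat.le_ceil (y ^ 2)
  have hm2 := (Nat.ceil_lt_add_one (sq_nonneg y)).le
  have hI : (I.card : ℝ) ≤ y ^ 2 := by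
    have h1 : (⌈y ^ 2⌉₊ : ℝ) * I.card ≤ y ^ 4 := by rw [← hcard]; exact_mod_cast hj
    have h2 : y ^ 2 * I.card ≤ y ^ 2 * y ^ 2 :=
      (mul_le_mul_of_nonneg_right hm1 (Nat.cast_nonneg _)).trans (h1.trans_eq (by ring))
    exact le_of_mul_le_mul_left h2 (by positivity)
  have hy23 : y ^ 2 ≤ y ^ 3 := pow_le_pow_right₀ hy (by norm_num)
  have hst' : (1 + 3 * ((⌈y⌉₊ + 4 : ℕ) : ℝ)) * (⟪s, e⟫ + j * (2 * d) - ⟪s, e⟫) +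
      30 * (Fintype.card ι * d / ((⌈y⌉₊ + 4 : ℕ) : ℝ)) + 44 * d ≤ 44 * R + 106 * (y ^ 3 * d) := by
    have h1 := Nat.le_ceil y
    have h2 := (Nat.ceil_lt_add_one hy0.le).le
    have h3 : Fintype.card ι * d / ((⌈y⌉₊ + 4 : ℕ) : ℝ) ≤ y ^ 3 * d := by
      rw [div_le_iff₀ (by positivity), hcard]
      push_cast
      calc y ^ 4 * d = y ^ 3 * d * y := by ring
        _ ≤ _ := by gcongr; linarith
    have h4 : (j : ℝ) ≤ 2 * y ^ 2 := by
      have : (j : ℝ) ≤ ⌈y ^ 2⌉₊ := by exact_mod_cast hjm.le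
      nlinarith
    have h5 : 1 + 3 * ((⌈y⌉₊ + 4 : ℕ) : ℝ) ≤ 19 * y := by push_cast; linarith
    have h6 : (1 + 3 * ((⌈y⌉₊ + 4 : ℕ) : ℝ)) * (⟪s, e⟫ + j * (2 * d) - ⟪s, e⟫) ≤
        19 * y * (2 * y ^ 2 * (2 * d)) := by
      rw [add_sub_cancel_left]; gcongr
    have h7 : 19 * y * (2 * y ^ 2 * (2 * d)) = 76 * (y ^ 3 * d) := by ring
    linarith [H.le]
  rcases htc with htc | htc
  · exact ⟨t, htc, hst.mono (hst'.trans (by linarith [H.le, show 0 ≤ y ^ 3 * d by positivity]))⟩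
  · have hf0 : f ≠ 0 := norm_ne_zero_iff.1 (by rw [hF.norm_f]; norm_num)
    obtain ⟨z, hz, hzfr⟩ := exists_ray_mem_frontier H.compact_outer hf0 ht.1
    have ht0 : t + (0 : ℝ) • f ∈ freeRegion P₀ Q := by simpa using ht
    have h1 := H.geodLE_line hF.norm_f (H.frontier_outer_subset hzfr) I 0 hz ht0
      fun i x _ hxi => Finset.mem_filter.2 ⟨Finset.mem_univ i, _, interior_subset hxi, by
        rw [inner_add_left, real_inner_smul_left, hF.inner_fe, htc, mul_zero, add_zero]⟩
    have h2 := H.dist_outer _ (H.frontier_outer_subset hzfr).1 _ ht0.1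
    rw [dist_comm, dist_line hz hF.norm_f] at h2
    rw [zero_smul, add_zero] at h1
    refine ⟨_, hzfr, (hst.trans h1).mono ?_⟩
    have h3 : 44 * d * I.card ≤ 44 * (y ^ 3 * d) := by nlinarith
    linarith

lemma geodDiam_le (H : HoleyDomain P₀ Q d R) {L : ℝ}
    (hL : ∀ s ∈ freeRegion P₀ Q, ∃ t ∈ frontier P₀, GeodLE (freeRegion P₀ Q) s t L) :
    geodDiam (freeRegion P₀ Q) ≤ ENNReal.ofReal (2 * L + 44 * R) := by
  refine iSup₂_le fun s hs => iSup₂_le fun t ht => ?_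
  obtain ⟨s', hs', h1⟩ := hL s hs
  obtain ⟨t', ht', h2⟩ := hL t ht
  exact (((h1.trans (H.geodLE_outer hs' ht')).trans h2.symm).mono (by linarith)).2

end HoleyDomain

lemma diam_eq_of_frontier_subset {P K : Set Plane} (hK : IsCompact K) (hP : P ⊆ K)
    (hfr : frontier K ⊆ P) : Metric.diam P = Metric.diam K := by
  refine le_antisymm (Metric.diam_mono hP hK.isBounded)
    (Metric.diam_le_of_forall_dist_le Metric.diam_nonneg fun x hx y hy => ?_)
  rcases eq_or_ne x y with rfl | hxy
  · simpa using Metric.diam_nonneg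
  obtain ⟨z, hz, hzfr⟩ := exists_ray_mem_frontier hK (sub_ne_zero.2 hxy) hx
  obtain ⟨w, hw, hwfr⟩ := exists_ray_mem_frontier hK (sub_ne_zero.2 hxy.symm) hy
  refine le_trans ?_ (Metric.dist_le_diam_of_mem (hK.isBounded.subset hP) (hfr hzfr) (hfr hwfr))
  have h : x + z • (x - y) - (y + w • (y - x)) = (1 + z + w) • (x - y) := by module
  rw [dist_eq_norm, dist_eq_norm, h, norm_smul, Real.norm_of_nonneg (by positivity)]
  nlinarith [norm_nonneg (x - y)]

lemma IsConvexPolygon.isCompact {K : Set Plane} (h : IsConvexPolygon K) : IsCompact K := by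
  obtain ⟨S, -, rfl⟩ := h
  exact S.finite_toSet.isCompact_convexHull ℝ

lemma IsConvexPolygon.convex {K : Set Plane} (h : IsConvexPolygon K) : Convex ℝ K := by
  obtain ⟨S, -, rfl⟩ := h
  exact convex_convexHull ℝ _

lemma IsConvexPolygon.nonempty {K : Set Plane} (h : IsConvexPolygon K) : K.Nonempty := by
  obtain ⟨S, hS, rfl⟩ := h
  exact hS.to_set.convexHull

/-- There is an absolute constant `C > 0` such that for every `h ≥ 1`, `Δ > 0`,
and every polygonal domain `P ∈ 𝒞(h)` whose holes satisfy `diam₂(Pᵢ) ≤ Δ·diam₂(P)`,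
we have `diam_g(P) ≤ C·(1 + min{h^{3/4}·Δ, h^{1/2}·Δ^{1/2}})·diam₂(P)`. -/
theorem geodesic_diameter_bounded_holes :
    ∃ C : ℝ, 0 < C ∧
      ∀ (h : ℕ), 1 ≤ h → ∀ (Δ : ℝ), 0 < Δ →
        ∀ (P₀ : Set Plane) (Q : Fin h → Set Plane),
          IsConvexPolygon P₀ →
          (∀ i, IsConvexPolygon (Q i)) →
          Pairwise (Function.onFun Disjoint Q) →
          (∀ i, Q i ⊆ interior P₀) →
          (∀ i, Metric.diam (Q i) ≤ Δ * Metric.diam (P₀ \ ⋃ j, interior (Q j))) →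
          geodDiam (P₀ \ ⋃ i, interior (Q i)) ≤
            ENNReal.ofReal
              (C * (1 + min ((h : ℝ) ^ ((3 : ℝ) / 4) * Δ)
                    ((h : ℝ) ^ ((1 : ℝ) / 2) * Δ ^ ((1 : ℝ) / 2))) *
                Metric.diam (P₀ \ ⋃ i, interior (Q i))) := by
  refine ⟨300, by norm_num, fun h hh Δ hΔ P₀ Q hP₀ hQ hdisj hsub hdiam => ?_⟩
  have hfr : frontier P₀ ⊆ freeRegion P₀ Q := fun x hx =>
    ⟨hP₀.isCompact.isClosed.frontier_subset hx, fun hx' => by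
      obtain ⟨i, hi⟩ := mem_iUnion.1 hx'
      exact hx.2 (hsub i (interior_subset hi))⟩
  have hR := diam_eq_of_frontier_subset hP₀.isCompact sdiff_subset hfr
  rw [hR] at hdiam ⊢
  have hdist : ∀ x ∈ P₀, ∀ y ∈ P₀, dist x y ≤ Metric.diam P₀ := fun x hx y hy =>
    Metric.dist_le_diam_of_mem hP₀.isCompact.isBounded hx hy
  obtain ⟨R, hRdef⟩ : ∃ R, R = Metric.diam P₀ := ⟨_, rfl⟩
  rw [← hRdef] at hdiam hdist ⊢
  rcases (hRdef ▸ Metric.diam_nonneg : 0 ≤ R).eq_or_lt with h0 | hpos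
  · refine iSup₂_le fun s hs => iSup₂_le fun t ht => ?_
    obtain rfl : s = t := dist_le_zero.1 (h0 ▸ hdist s hs.1 t ht.1)
    have := (geodLE_of_segment (P := freeRegion P₀ Q) (s := s) (t := s)
      (by simpa [segment_same] using hs)).2
    rw [dist_self, ENNReal.ofReal_zero] at this
    exact this.trans zero_le
  have hdle : ∀ i, Metric.diam (Q i) ≤ min Δ 1 * R := fun i => by
    rcases min_choice Δ 1 with h1 | h1 <;> rw [h1]
    · exact hdiam i
    · rw [one_mul, hRdef]
      exact Metric.diam_mono ((hsub i).trans interior_subset) hP₀.isCompact.isBounded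
  have hD : 0 < min Δ 1 := lt_min hΔ one_pos
  have H : HoleyDomain P₀ Q (min Δ 1 * R) R :=
    { compact_outer := hP₀.isCompact
      convex_outer := hP₀.convex
      compact_hole := fun i => (hQ i).isCompact
      convex_hole := fun i => (hQ i).convex
      disjoint := hdisj
      subset := hsub
      dist_hole := fun i x hx y hy =>
        (Metric.dist_le_diam_of_mem (hQ i).isCompact.isBounded hx hy).trans (hdle i)
      dist_outer := hdist
      pos := mul_pos hD hpos
      le := mul_le_of_le_one_left hpos.le (min_le_right _ _) }
  have hne : ∀ i, (Q i).Nonempty := fun i => (hQ i).nonempty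
  have hh' : (1 : ℝ) ≤ h := by exact_mod_cast hh
  have hh0 : (0 : ℝ) ≤ h := by linarith
  rcases min_choice ((h : ℝ) ^ ((3 : ℝ) / 4) * Δ)
    ((h : ℝ) ^ ((1 : ℝ) / 2) * Δ ^ ((1 : ℝ) / 2)) with hmin | hmin <;> rw [hmin]
  · refine (H.geodDiam_le fun s hs => H.exists_geodLE_frontier_outer_of_card_eq hne
      (y := (h : ℝ) ^ ((1 : ℝ) / 4)) (Real.one_le_rpow hh' (by norm_num)) ?_ hs).trans
      (ENNReal.ofReal_le_ofReal ?_)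
    · rw [← Real.rpow_natCast, ← Real.rpow_mul hh0]; norm_num
    · have h3 : ((h : ℝ) ^ ((1 : ℝ) / 4)) ^ 3 = (h : ℝ) ^ ((3 : ℝ) / 4) := by
        rw [← Real.rpow_natCast, ← Real.rpow_mul hh0]; norm_num
      rw [h3]
      have h4 : (h : ℝ) ^ ((3 : ℝ) / 4) * (min Δ 1 * R) ≤ (h : ℝ) ^ ((3 : ℝ) / 4) * (Δ * R) := by
        gcongr; exact min_le_left _ _
      linarith
  · refine (H.geodDiam_le fun s hs => H.exists_geodLE_frontier_outer_of_card_mul_eq hne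
      (Real.sqrt_nonneg (h * min Δ 1)) ?_ hs).trans (ENNReal.ofReal_le_ofReal ?_)
    · rw [Real.sq_sqrt (by positivity), Fintype.card_fin]; ring
    · have h3 : √(h * min Δ 1) ≤ (h : ℝ) ^ ((1 : ℝ) / 2) * Δ ^ ((1 : ℝ) / 2) := by
        rw [← Real.sqrt_eq_rpow, ← Real.sqrt_eq_rpow, ← Real.sqrt_mul hh0]
        gcongr; exact min_le_left _ _
      have h4 := mul_le_mul_of_nonneg_right h3 hpos.le
      have h5 : 0 ≤ √(h * min Δ 1) * R := by positivity
      linarith
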